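/- arXiv:1807.08384 — 3 statements merged into one kernel-verified Lean document; each statement's English description precedes it below -/
import Mathlib

section
/- Let K and L be finite lattices such that K is a subposet of L via an order embedding f : K → L, and assume |Jred(L)| = |Jred(K)|. If u₁, u₂, v₁, v₂ ∈ K satisfy u₁ ∥ u₂ (u₁ and u₂ are incomparable), v₁ ∥ v₂, and u₁ ⊔_K u₂ = v₁ ⊔_K v₂ in K, then f(u₁) ⊔_L f(u₂) = f(v₁) ⊔_L f(v₂) in L. The dual statement (with meets, under the hypothesis |Mred(L)| = |Mred(K)|) also holds. -/
/-- An element is join-reducible iff it is the join of two incomparable elements. -/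
theorem not_isMin_and_not_supIrred_iff {α : Type*} [Lattice α] {x : α} :
    ¬ IsMin x ∧ ¬ SupIrred x ↔ ∃ a b : α, (¬ a ≤ b ∧ ¬ b ≤ a) ∧ a ⊔ b = x := by
  constructor
  · rintro ⟨hmin, hirr⟩
    obtain ⟨a, b, rfl, ha, hb⟩ := (not_supIrred.mp hirr).resolve_left hmin
    exact ⟨a, b, ⟨fun h => hb.ne (sup_eq_right.mpr h).symm,
      fun h => ha.ne (sup_eq_left.mpr h).symm⟩, rfl⟩
  · rintro ⟨a, b, ⟨hab, hba⟩, rfl⟩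
    refine ⟨fun h => hab (le_sup_left.trans (h le_sup_right)), ?_⟩
    exact not_supIrred.mpr (Or.inr ⟨a, b, rfl, left_lt_sup.mpr hba, right_lt_sup.mpr hab⟩)

/-- Pairs whose images under an order embedding have the same join have the same join. -/
theorem OrderEmbedding.sup_eq_sup_of_map_sup_map_eq {K L : Type*} [Lattice K] [Lattice L]
    (f : K ↪o L) {a b c d : K} (h : f a ⊔ f b = f c ⊔ f d) : a ⊔ b = c ⊔ d := by
  have key {a b c d : K} (h : f a ⊔ f b = f c ⊔ f d) : a ⊔ b ≤ c ⊔ d := by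
    have hle : f a ⊔ f b ≤ f (c ⊔ d) := h.trans_le (f.monotone.le_map_sup c d)
    exact sup_le (f.le_iff_le.mp (le_sup_left.trans hle)) (f.le_iff_le.mp (le_sup_right.trans hle))
  exact (key h).antisymm (key h.symm)

/-- If an order embedding preserves the number of join-reducible elements, the join of the images
of an incomparable pair depends only on the join of the pair. -/
theorem OrderEmbedding.map_sup_map_eq_of_ncard_eq {K L : Type*} [Lattice K] [Lattice L]
    [Finite L] (f : K ↪o L) {u₁ u₂ v₁ v₂ : K}
    (hu : ¬ u₁ ≤ u₂ ∧ ¬ u₂ ≤ u₁) (hv : ¬ v₁ ≤ v₂ ∧ ¬ v₂ ≤ v₁)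
    (hcard : Set.ncard {x : L | ¬ IsMin x ∧ ¬ SupIrred x} =
      Set.ncard {x : K | ¬ IsMin x ∧ ¬ SupIrred x})
    (h : u₁ ⊔ u₂ = v₁ ⊔ v₂) : f u₁ ⊔ f u₂ = f v₁ ⊔ f v₂ := by
  have hchoice (x : K) : ∃ p : K × K, (¬ IsMin x ∧ ¬ SupIrred x →
      (¬ p.1 ≤ p.2 ∧ ¬ p.2 ≤ p.1) ∧ p.1 ⊔ p.2 = x) ∧ (x = u₁ ⊔ u₂ → p = (u₁, u₂)) := by
    by_cases hx : x = u₁ ⊔ u₂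
    · exact ⟨(u₁, u₂), fun _ => ⟨hu, hx.symm⟩, fun _ => rfl⟩
    · by_cases hred : ¬ IsMin x ∧ ¬ SupIrred x
      · obtain ⟨a, b, hab, rfl⟩ := not_isMin_and_not_supIrred_iff.mp hred
        exact ⟨(a, b), fun _ => ⟨hab, rfl⟩, fun e => absurd e hx⟩
      · exact ⟨(x, x), fun e => absurd e hred, fun e => absurd e hx⟩
  choose p hp hpu using hchoice
  let g (x : K) : L := f (p x).1 ⊔ f (p x).2
  have hmaps {a b : K} (hab : ¬ a ≤ b ∧ ¬ b ≤ a) :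
      f a ⊔ f b ∈ {x : L | ¬ IsMin x ∧ ¬ SupIrred x} :=
    not_isMin_and_not_supIrred_iff.mpr
      ⟨f a, f b, by simpa only [f.le_iff_le] using hab, rfl⟩
  have hsub : g '' {x : K | ¬ IsMin x ∧ ¬ SupIrred x} ⊆ {x : L | ¬ IsMin x ∧ ¬ SupIrred x} := by
    rintro _ ⟨x, hx, rfl⟩
    exact hmaps (hp x hx).1
  have hinj : Set.InjOn g {x : K | ¬ IsMin x ∧ ¬ SupIrred x} := by
    intro x hx y hy hxy
    rw [← (hp x hx).2, ← (hp y hy).2]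
    exact f.sup_eq_sup_of_map_sup_map_eq hxy
  have himage := Set.eq_of_subset_of_ncard_le hsub (by rw [hinj.ncard_image, hcard])
  obtain ⟨y, hy, hyv⟩ := himage.symm.subset (hmaps hv)
  have hyu : y = u₁ ⊔ u₂ := by
    rw [h, ← f.sup_eq_sup_of_map_sup_map_eq hyv, (hp y hy).2]
  simpa only [g, hpu y hyu] using hyv

/-- Let `f : K ↪o L` be an order embedding between finite lattices.
If `L` and `K` have the same number of join-reducible elements, then for incomparable
pairs `u₁ ∥ u₂` and `v₁ ∥ v₂` in `K` with `u₁ ⊔ u₂ = v₁ ⊔ v₂` in `K`, we also have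
`f u₁ ⊔ f u₂ = f v₁ ⊔ f v₂` in `L`.  The dual statement for meets (under equality of the
numbers of meet-reducible elements) also holds. -/
theorem join_eq_of_card_joinReducible_eq
    {K L : Type*} [Lattice K] [Lattice L] [Fintype K] [Fintype L]
    (f : K ↪o L) (u₁ u₂ v₁ v₂ : K)
    (hu : ¬ u₁ ≤ u₂ ∧ ¬ u₂ ≤ u₁) (hv : ¬ v₁ ≤ v₂ ∧ ¬ v₂ ≤ v₁) :
    (Set.ncard {x : L | ¬ IsMin x ∧ ¬ SupIrred x} =
        Set.ncard {x : K | ¬ IsMin x ∧ ¬ SupIrred x} →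
      u₁ ⊔ u₂ = v₁ ⊔ v₂ → f u₁ ⊔ f u₂ = f v₁ ⊔ f v₂) ∧
    (Set.ncard {x : L | ¬ IsMax x ∧ ¬ InfIrred x} =
        Set.ncard {x : K | ¬ IsMax x ∧ ¬ InfIrred x} →
      u₁ ⊓ u₂ = v₁ ⊓ v₂ → f u₁ ⊓ f u₂ = f v₁ ⊓ f v₂) := by
  exact ⟨f.map_sup_map_eq_of_ncard_eq hu hv,
    OrderEmbedding.map_sup_map_eq_of_ncard_eq (K := Kᵒᵈ) (L := Lᵒᵈ) f.dual hu.symm hv.symm⟩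
end

section
/- Let L be a finite distributive lattice and let ⊥ = a₀ ⋖ a₁ ⋖ ⋯ ⋖ a_t = ⊤ be a maximal chain in L (each a_{i−1} is covered by a_i). Then the principal congruences con(a_{i−1}, a_i), for i ∈ {1, …, t}, are pairwise distinct: if i ≠ j then con(a_{i−1}, a_i) ≠ con(a_{j−1}, a_j). -/
/-- A lattice congruence: an equivalence relation compatible with join and meet. -/
def IsLatCongr {L : Type*} [Lattice L] (θ : L → L → Prop) : Prop :=
  Equivalence θ ∧
    ∀ a b c d : L, θ a b → θ c d → θ (a ⊔ c) (b ⊔ d) ∧ θ (a ⊓ c) (b ⊓ d)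

/-- `latConGen a b` is the smallest congruence collapsing `a` and `b`. -/
def latConGen {L : Type*} [Lattice L] (a b : L) : L → L → Prop :=
  fun x y => ∀ θ : L → L → Prop, IsLatCongr θ → θ a b → θ x y

/-- In a distributive lattice, having the same join with `c` is a congruence. -/
theorem isLatCongr_sup_right_eq {L : Type*} [DistribLattice L] (c : L) :
    IsLatCongr fun x y : L => x ⊔ c = y ⊔ c := by
  refine ⟨⟨fun _ => rfl, fun h => h.symm, fun h h' => h.trans h'⟩, fun x y z w h h' => ⟨?_, ?_⟩⟩
  · change x ⊔ z ⊔ c = y ⊔ w ⊔ c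
    rw [sup_sup_distrib_right, h, h', ← sup_sup_distrib_right]
  · change x ⊓ z ⊔ c = y ⊓ w ⊔ c
    rw [sup_inf_right, h, h', ← sup_inf_right]

theorem latConGen_self {L : Type*} [Lattice L] (a b : L) : latConGen a b a b :=
  fun _ _ h => h

/-- The congruence generated by a pair below `x` does not collapse a nontrivial interval
starting at `x`. -/
theorem not_latConGen_of_le_of_lt {L : Type*} [DistribLattice L] {a b x y : L}
    (hab : a ≤ b) (hbx : b ≤ x) (hxy : x < y) : ¬ latConGen a b x y := by
  intro h
  have key : x ⊔ b = y ⊔ b := h _ (isLatCongr_sup_right_eq b) (by simp [hab])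
  rw [sup_eq_left.2 hbx, sup_eq_left.2 (hbx.trans hxy.le)] at key
  exact hxy.ne key

theorem latConGen_ne_of_le_of_lt {L : Type*} [DistribLattice L] {a b x y : L}
    (hab : a ≤ b) (hbx : b ≤ x) (hxy : x < y) : latConGen a b ≠ latConGen x y :=
  fun h => not_latConGen_of_le_of_lt hab hbx hxy (h ▸ latConGen_self x y)

/-- If `⊥ = a₀ ⋖ a₁ ⋖ ⋯ ⋖ a_t = ⊤` is a maximal chain in a finite
distributive lattice `L` (the bottom is the minimum, the top the maximum, and consecutive
members form covering pairs), then the congruences `con(a_{i-1}, a_i)` are pairwise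
distinct. -/
theorem con_of_maximal_chain_distinct
    {L : Type*} [DistribLattice L] [Fintype L] {t : ℕ}
    (a : Fin (t + 1) → L) (h0 : IsMin (a 0)) (htop : IsMax (a (Fin.last t)))
    (hcov : ∀ i : Fin t, a i.castSucc ⋖ a i.succ) :
    ∀ i j : Fin t, i ≠ j →
      latConGen (a i.castSucc) (a i.succ) ≠ latConGen (a j.castSucc) (a j.succ) := by
  have hmono : Monotone a := Fin.monotone_iff_le_succ.2 fun i => (hcov i).le
  have hlt : ∀ i j : Fin t, i < j →
      latConGen (a i.castSucc) (a i.succ) ≠ latConGen (a j.castSucc) (a j.succ) :=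
    fun i j hij => latConGen_ne_of_le_of_lt (hcov i).le
      (hmono (Fin.succ_le_castSucc_iff.2 hij)) (hcov j).lt
  intro i j hij
  rcases hij.lt_or_gt with h | h
  · exact hlt i j h
  · exact (hlt j i h).symm
end

section
/- Let K and L be finite lattices such that K is a subposet of L (there is an order embedding f : K → L), and suppose that K has at least 4 join-reducible elements or at least 4 meet-reducible elements (|Jred(K)| ≥ 4 or |Mred(K)| ≥ 4). Then |Con(L)| ≤ 2^(|L|−5). -/
namespace IsLatCongr

variable {L : Type*} [Lattice L] {θ φ : L → L → Prop}

theorem sup_right (h : IsLatCongr θ) {a b : L} (hab : θ a b) (c : L) : θ (a ⊔ c) (b ⊔ c) :=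
  (h.2 a b c c hab (h.1.refl c)).1

theorem inf_right (h : IsLatCongr θ) {a b : L} (hab : θ a b) (c : L) : θ (a ⊓ c) (b ⊓ c) :=
  (h.2 a b c c hab (h.1.refl c)).2

theorem iff_inf_sup (h : IsLatCongr θ) {a b : L} : θ a b ↔ θ (a ⊓ b) (a ⊔ b) := by
  refine ⟨fun hab => ?_, fun hab => ?_⟩
  · have h₁ : θ (a ⊓ b) b := by simpa using h.inf_right hab b
    have h₂ : θ (a ⊔ b) b := by simpa using h.sup_right hab b
    exact h.1.trans h₁ (h.1.symm h₂)
  · have h₁ : θ a (a ⊔ b) := by simpa [sup_comm] using h.sup_right hab a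
    have h₂ : θ b (a ⊔ b) := by simpa [sup_comm] using h.sup_right hab b
    exact h.1.trans h₁ (h.1.symm h₂)

/-- The sup-irreducible elements that a relation identifies with some strictly smaller element. -/
def collapsed (θ : L → L → Prop) : Set {p : L // SupIrred p} :=
  {p | ∃ q < p.1, θ q p.1}

theorem of_covBy [Finite L] (hθ : IsLatCongr θ) (hφ : IsLatCongr φ)
    (hS : collapsed θ ⊆ collapsed φ) {c b : L} (hcb : c ⋖ b) (h : θ c b) : φ c b := by
  obtain ⟨p, ⟨hpb, hpc⟩, hmin⟩ :=
    (wellFounded_lt (α := L)).has_min {p | p ≤ b ∧ ¬ p ≤ c} ⟨b, le_rfl, hcb.lt.not_ge⟩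
  have below : ∀ q < p, q ≤ c := fun q hq => by
    by_contra hqc
    exact hmin q ⟨hq.le.trans hpb, hqc⟩ hq
  have hp : SupIrred p := by
    refine ⟨fun hm => hpc ((hm inf_le_left).trans inf_le_right), fun x y hxy => ?_⟩
    by_contra! hne
    have hx : x < p := lt_of_le_of_ne (hxy ▸ le_sup_left) hne.1
    have hy : y < p := lt_of_le_of_ne (hxy ▸ le_sup_right) hne.2
    exact hpc (hxy ▸ sup_le (below x hx) (below y hy))
  have hmem : (⟨p, hp⟩ : {p : L // SupIrred p}) ∈ collapsed θ := by
    refine ⟨p ⊓ c, inf_lt_left.2 hpc, ?_⟩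
    have := hθ.inf_right h p
    rwa [inf_eq_right.2 hpb, inf_comm] at this
  obtain ⟨q, hq, hqp⟩ := hS hmem
  have hsup : p ⊔ c = b :=
    (hcb.eq_or_eq le_sup_right (sup_le hpb hcb.le)).resolve_left fun h => hpc (sup_eq_right.1 h)
  have := hφ.sup_right hqp c
  rwa [sup_eq_right.2 (below q hq), hsup] at this

theorem of_le [Finite L] (hθ : IsLatCongr θ) (hφ : IsLatCongr φ)
    (hS : collapsed θ ⊆ collapsed φ) {a b : L} (hab : a ≤ b) (h : θ a b) : φ a b := by
  induction b using (wellFounded_lt (α := L)).induction with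
  | _ b ih =>
    rcases hab.eq_or_lt with rfl | hlt
    · exact hφ.1.refl _
    obtain ⟨c, hac, hcb⟩ := exists_le_covBy_of_lt hlt
    have h₁ : θ c b := by
      have := hθ.sup_right h c
      rwa [sup_eq_right.2 hac, sup_eq_left.2 hcb.le] at this
    have h₂ : θ a c := by
      have := hθ.inf_right h c
      rwa [inf_eq_left.2 hac, inf_eq_right.2 hcb.le] at this
    exact hφ.1.trans (ih c hcb.lt hac h₂) (hθ.of_covBy hφ hS hcb h₁)

theorem le_of_collapsed_subset [Finite L] (hθ : IsLatCongr θ) (hφ : IsLatCongr φ)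
    (hS : collapsed θ ⊆ collapsed φ) {a b : L} (h : θ a b) : φ a b :=
  hφ.iff_inf_sup.2 (hθ.of_le hφ hS inf_le_sup (hθ.iff_inf_sup.1 h))

theorem dual (h : IsLatCongr θ) :
    IsLatCongr (L := Lᵒᵈ) fun a b => θ (OrderDual.ofDual a) (OrderDual.ofDual b) :=
  ⟨⟨fun _ => h.1.refl _, h.1.symm, h.1.trans⟩,
    fun a b c d hab hcd => (h.2 a.ofDual b.ofDual c.ofDual d.ofDual hab hcd).symm⟩

theorem card_le_two_pow_supIrred [Finite L] :
    Nat.card {θ : L → L → Prop // IsLatCongr θ} ≤ 2 ^ {p : L | SupIrred p}.ncard := by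
  have hinj : Function.Injective
      fun θ : {θ : L → L → Prop // IsLatCongr θ} => collapsed θ.1 := by
    intro θ φ h
    ext a b
    exact ⟨θ.2.le_of_collapsed_subset φ.2 h.le, φ.2.le_of_collapsed_subset θ.2 h.ge⟩
  refine (Nat.card_le_card_of_injective _ hinj).trans_eq ?_
  have : Fintype {p : L // SupIrred p} := Fintype.ofFinite _
  rw [Nat.card_eq_fintype_card, Fintype.card_set, ← Nat.card_eq_fintype_card]
  rfl

theorem card_le_card_dual [Finite L] :
    Nat.card {θ : L → L → Prop // IsLatCongr θ} ≤
      Nat.card {θ : Lᵒᵈ → Lᵒᵈ → Prop // IsLatCongr θ} := by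
  have : Finite Lᵒᵈ := inferInstanceAs (Finite L)
  refine Nat.card_le_card_of_injective (fun θ => ⟨_, θ.2.dual⟩) fun θ φ h => ?_
  have h' := Subtype.mk.inj h
  ext a b
  exact iff_of_eq (congrFun₂ h' (OrderDual.toDual a) (OrderDual.toDual b))

end IsLatCongr

/-- A finite lattice has at least as many join-reducible elements as any lattice that is a
subposet of it. -/
theorem ncard_supReducible_le {K L : Type*} [Lattice K] [Lattice L] [Finite L] (f : K ↪o L) :
    {x : K | ¬ IsMin x ∧ ¬ SupIrred x}.ncard ≤ {x : L | ¬ IsMin x ∧ ¬ SupIrred x}.ncard := by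
  have key : ∀ x : K, ¬ IsMin x ∧ ¬ SupIrred x → ∃ a b, a ⊔ b = x ∧ a < x ∧ b < x := by
    rintro x ⟨hx, hirr⟩
    simpa [hx] using not_supIrred.1 hirr
  choose! a b hsup ha hb using key
  refine Set.ncard_le_ncard_of_injOn (fun x => f (a x) ⊔ f (b x)) (fun x hx => ?_) ?_
    (Set.toFinite _)
  · have hab : ¬ a x ≤ b x := fun h => (hb x hx).ne (sup_eq_right.2 h ▸ hsup x hx)
    have hba : ¬ b x ≤ a x := fun h => (ha x hx).ne (sup_eq_left.2 h ▸ hsup x hx)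
    refine ⟨fun hm => hba ?_, fun hirr => ?_⟩
    · exact f.le_iff_le.1 (le_sup_right.trans (hm le_sup_left))
    · rcases hirr.2 rfl with h | h
      · exact hba (f.le_iff_le.1 (sup_eq_left.1 h.symm))
      · exact hab (f.le_iff_le.1 (sup_eq_right.1 h.symm))
  · have hle : ∀ x, ¬ IsMin x ∧ ¬ SupIrred x → ∀ y, ¬ IsMin y ∧ ¬ SupIrred y →
        f (a x) ⊔ f (b x) = f (a y) ⊔ f (b y) → x ≤ y := by
      intro x hx y hy h
      have hy' : f (a x) ⊔ f (b x) ≤ f y :=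
        h ▸ sup_le (f.monotone (ha y hy).le) (f.monotone (hb y hy).le)
      rw [← hsup x hx]
      exact sup_le (f.le_iff_le.1 (le_sup_left.trans hy')) (f.le_iff_le.1 (le_sup_right.trans hy'))
    exact fun x hx y hy h => le_antisymm (hle x hx y hy h) (hle y hy x hx h.symm)

theorem ncard_supIrred_add_ncard_supReducible_lt {L : Type*} [Lattice L] [Finite L] [Nonempty L] :
    {p : L | SupIrred p}.ncard + {x : L | ¬ IsMin x ∧ ¬ SupIrred x}.ncard < Nat.card L := by
  obtain ⟨m, hm⟩ : ∃ m : L, IsMin m := by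
    obtain ⟨m, -, hm⟩ := (wellFounded_lt (α := L)).has_min Set.univ Set.univ_nonempty
    exact ⟨m, isMin_iff_forall_not_lt.2 fun x => hm x trivial⟩
  have hdisj : Disjoint {p : L | SupIrred p} {x : L | ¬ IsMin x ∧ ¬ SupIrred x} :=
    Set.disjoint_left.2 fun p hp h => h.2 hp
  rw [← Set.ncard_union_eq hdisj]
  refine Set.ncard_lt_card fun h => ?_
  rcases h.ge (Set.mem_univ m) with h | h
  · exact h.1 hm
  · exact h.1 hm

theorem card_congr_le_of_subposet_with_four_supReducible
    {K L : Type*} [Lattice K] [Lattice L] [Finite L] (f : K ↪o L)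
    (h : 4 ≤ {x : K | ¬ IsMin x ∧ ¬ SupIrred x}.ncard) :
    Nat.card {θ : L → L → Prop // IsLatCongr θ} ≤ 2 ^ (Nat.card L - 5) := by
  obtain ⟨x, -⟩ := Set.nonempty_of_ncard_ne_zero (pos_of_gt h).ne'
  have : Nonempty L := ⟨f x⟩
  have h₁ := ncard_supReducible_le f
  have h₂ := ncard_supIrred_add_ncard_supReducible_lt (L := L)
  exact IsLatCongr.card_le_two_pow_supIrred.trans (Nat.pow_le_pow_right two_pos (by omega))

/-- If a finite lattice `K` with at least 4 join-reducible elements or at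
least 4 meet-reducible elements is a subposet of a finite lattice `L` (witnessed by an
order embedding `f : K ↪o L`), then `L` has at most `2 ^ (|L| - 5)` congruences. -/
theorem card_congr_le_of_subposet_with_four_reducible
    {K L : Type*} [Lattice K] [Lattice L] [Fintype K] [Fintype L]
    (f : K ↪o L)
    (h : 4 ≤ Set.ncard {x : K | ¬ IsMin x ∧ ¬ SupIrred x} ∨
         4 ≤ Set.ncard {x : K | ¬ IsMax x ∧ ¬ InfIrred x}) :
    Nat.card {θ : L → L → Prop // IsLatCongr θ} ≤ 2 ^ (Fintype.card L - 5) := by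
  rw [← Nat.card_eq_fintype_card]
  rcases h with h | h
  · exact card_congr_le_of_subposet_with_four_supReducible f h
  · have : Finite Lᵒᵈ := inferInstanceAs (Finite L)
    have hdual : {x : Kᵒᵈ | ¬ IsMin x ∧ ¬ SupIrred x}.ncard =
        {x : K | ¬ IsMax x ∧ ¬ InfIrred x}.ncard := by
      rw [← Set.ncard_preimage_of_injective_subset_range OrderDual.toDual.injective
        (by simp [OrderDual.toDual.surjective.range_eq])]
      simp only [Set.preimage_ofPred_eq, isMin_toDual_iff, supIrred_toDual]
    exact IsLatCongr.card_le_card_dual.trans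
      (card_congr_le_of_subposet_with_four_supReducible f.dual (hdual ▸ h))
end
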